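/- For k = 1,2 let H_k = S_k⁻ᵀD_kS_k⁻¹ be Hamiltonian matrices with symplectic diagonalizations (S_k symplectic, D_k = diag with positive entries in pairs) and let V_k := (1/2)·S_k·coth(D_k)·S_kᵀ be the corresponding covariance matrices. Write S := S₁ and d_max for the largest diagonal entry of D₁, and set a := e^{−2 d_max}·‖S‖∞⁻²/(1 − e^{−2 d_max}). If ‖V₁ − V₂‖∞ < a, then ‖H₁ − H₂‖∞ ≤ 2·(2a)⁻¹·(2a − 2‖V₁ − V₂‖∞)⁻¹·‖V₁ − V₂‖∞. -/

import Mathlib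

open Matrix

/-- The spectral norm (ℓ²→ℓ² operator norm, largest singular value) of a matrix. -/
noncomputable def spNorm {𝕜 : Type*} [RCLike 𝕜] {p q : Type*} [Fintype p] [Fintype q]
    [DecidableEq q] (A : Matrix p q 𝕜) : ℝ :=
  ‖LinearMap.toContinuousLinearMap (Matrix.toEuclideanLin A)‖

/-- Index set for `2m × 2m` matrices: the pair `(i, δ)` stands for the index `2i - δ`,
`(i, 0)` being the first index of the `i`-th pair and `(i, 1)` the second. -/
abbrev Idx (m : ℕ) := Fin m × Fin 2

/-- The standard symplectic form: block diagonal with `m` blocks `[[0,1],[-1,0]]`. -/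
def Omega (m : ℕ) : Matrix (Idx m) (Idx m) ℝ :=
  Matrix.of fun p q =>
    if p.1 = q.1 ∧ p.2 = 0 ∧ q.2 = 1 then 1
    else if p.1 = q.1 ∧ p.2 = 1 ∧ q.2 = 0 then -1 else 0

/-- The diagonal matrix `diag (d₁, d₁, …, d_m, d_m)`. -/
def pairDiag {m : ℕ} (d : Fin m → ℝ) : Matrix (Idx m) (Idx m) ℝ :=
  Matrix.diagonal fun p => d p.1

/-- Hyperbolic cotangent. -/
noncomputable def rcoth (x : ℝ) : ℝ := Real.cosh x / Real.sinh x

/-- A real matrix regarded as a complex matrix. -/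
def cplx {p q : Type*} (A : Matrix p q ℝ) : Matrix p q ℂ :=
  A.map (fun x => (x : ℂ))


lemma aux_sqrt_norm {ι : Type*} [Fintype ι] (x : ι → ℝ) :
    ‖(WithLp.toLp 2 x : EuclideanSpace ℝ ι)‖ = Real.sqrt (x ⬝ᵥ x) := by
  rw [EuclideanSpace.norm_eq]
  congr 1
  simp [dotProduct, sq]

lemma aux_norm_sq {ι : Type*} [Fintype ι] (x : ι → ℝ) :
    ‖(WithLp.toLp 2 x : EuclideanSpace ℝ ι)‖ ^ 2 = x ⬝ᵥ x := by
  rw [aux_sqrt_norm, Real.sq_sqrt]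
  simpa using dotProduct_star_self_nonneg x

lemma aux_dot_le {ι : Type*} [Fintype ι] (x y : ι → ℝ) :
    |x ⬝ᵥ y| ≤ ‖(WithLp.toLp 2 x : EuclideanSpace ℝ ι)‖ *
      ‖(WithLp.toLp 2 y : EuclideanSpace ℝ ι)‖ := by
  have h := abs_real_inner_le_norm (WithLp.toLp 2 x : EuclideanSpace ℝ ι) (WithLp.toLp 2 y)
  have e : inner ℝ (WithLp.toLp 2 x : EuclideanSpace ℝ ι) (WithLp.toLp 2 y) = x ⬝ᵥ y := by
    simp [EuclideanSpace.inner_toLp_toLp, dotProduct_comm]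
  rwa [e] at h

lemma spNorm_mulVec {ι : Type*} [Fintype ι] [DecidableEq ι] (A : Matrix ι ι ℝ) (y : ι → ℝ) :
    ‖(WithLp.toLp 2 (A *ᵥ y) : EuclideanSpace ℝ ι)‖ ≤
      spNorm A * ‖(WithLp.toLp 2 y : EuclideanSpace ℝ ι)‖ := by
  have := (LinearMap.toContinuousLinearMap (Matrix.toEuclideanLin A)).le_opNorm (WithLp.toLp 2 y)
  simpa [spNorm] using this

lemma spNorm_nonneg' {ι : Type*} [Fintype ι] [DecidableEq ι] (A : Matrix ι ι ℝ) :
    0 ≤ spNorm A := norm_nonneg _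

lemma spNorm_bilin {ι : Type*} [Fintype ι] [DecidableEq ι] (A : Matrix ι ι ℝ) (x y : ι → ℝ) :
    |x ⬝ᵥ A *ᵥ y| ≤ spNorm A * (‖(WithLp.toLp 2 x : EuclideanSpace ℝ ι)‖ *
      ‖(WithLp.toLp 2 y : EuclideanSpace ℝ ι)‖) := by
  refine (aux_dot_le _ _).trans ?_
  have := mul_le_mul_of_nonneg_left (spNorm_mulVec A y)
    (norm_nonneg (WithLp.toLp 2 x : EuclideanSpace ℝ ι))
  linarith

lemma spNorm_le_of {ι : Type*} [Fintype ι] [DecidableEq ι] (A : Matrix ι ι ℝ) (K : ℝ)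
    (hK : 0 ≤ K) (h : ∀ x y : ι → ℝ, |x ⬝ᵥ A *ᵥ y| ≤
      K * (‖(WithLp.toLp 2 x : EuclideanSpace ℝ ι)‖ *
      ‖(WithLp.toLp 2 y : EuclideanSpace ℝ ι)‖)) : spNorm A ≤ K := by
  refine ContinuousLinearMap.opNorm_le_bound _ hK fun z => ?_
  have e : LinearMap.toContinuousLinearMap (Matrix.toEuclideanLin A) z
      = WithLp.toLp 2 (A *ᵥ z.ofLp) := rfl
  rw [e]
  have h1 := h (A *ᵥ z.ofLp) z.ofLp
  rw [← aux_norm_sq, abs_of_nonneg (sq_nonneg _)] at h1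
  have e2 : (WithLp.toLp 2 z.ofLp : EuclideanSpace ℝ ι) = z := rfl
  rw [e2] at h1
  rcases (norm_nonneg (WithLp.toLp 2 (A *ᵥ z.ofLp) : EuclideanSpace ℝ ι)).eq_or_lt with h0 | h0
  · rw [← h0]; positivity
  · refine le_of_mul_le_mul_right ?_ h0
    nlinarith

lemma Omega_mulVec (m : ℕ) (x : Idx m → ℝ) (i : Fin m) :
    (Omega m *ᵥ x) (i, 0) = x (i, 1) ∧ (Omega m *ᵥ x) (i, 1) = - x (i, 0) := by
  simp [Matrix.mulVec, dotProduct, Omega, Fintype.sum_prod_type, Fin.sum_univ_two]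

lemma Omega_sq (m : ℕ) (x : Idx m → ℝ) : Omega m *ᵥ (Omega m *ᵥ x) = -x := by
  ext ⟨i, j⟩
  fin_cases j
  · simp [Omega_mulVec]
  · simp [Omega_mulVec]

lemma Omega_mul (m : ℕ) : Omega m * Omega m = -1 := by
  apply Matrix.toLin'.injective
  refine LinearMap.ext fun x => ?_
  rw [Matrix.toLin'_apply, Matrix.toLin'_apply, ← Matrix.mulVec_mulVec, Omega_sq,
    Matrix.neg_mulVec, Matrix.one_mulVec]

lemma Omega_norm (m : ℕ) (x : Idx m → ℝ) : (Omega m *ᵥ x) ⬝ᵥ (Omega m *ᵥ x) = x ⬝ᵥ x := by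
  simp only [dotProduct, Fintype.sum_prod_type, Fin.sum_univ_two, Omega_mulVec]
  refine Finset.sum_congr rfl fun i _ => ?_
  ring

lemma Omega_comm {m : ℕ} (c : Fin m → ℝ) :
    Omega m * pairDiag c = pairDiag c * Omega m := by
  ext p q
  simp only [pairDiag, Matrix.mul_diagonal, Matrix.diagonal_mul, Omega, Matrix.of_apply]
  split_ifs with h1 h2
  · rw [h1.1]; ring
  · rw [h2.1]; ring
  · ring

lemma rcoth_sub_one {d : ℝ} (hd : 0 < d) :
    rcoth d - 1 = 2 * (Real.exp (-2 * d) / (1 - Real.exp (-2 * d))) := by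
  have h1 : Real.exp (-2 * d) < 1 := by rw [Real.exp_lt_one_iff]; linarith
  have h2 : Real.exp (-2 * d) = Real.exp (-d) * Real.exp (-d) := by
    rw [← Real.exp_add]; ring_nf
  have h3 : Real.exp d * Real.exp (-d) = 1 := by rw [← Real.exp_add]; simp
  have hs : 0 < Real.sinh d := Real.sinh_pos_iff.2 hd
  have h4 : Real.exp d - Real.exp (-d) ≠ 0 := by
    rw [Real.sinh_eq] at hs; intro h; rw [h] at hs; simp at hs
  have h5 : 1 - Real.exp (-2 * d) ≠ 0 := by linarith
  have h6 : rcoth d - 1 = 2 * Real.exp (-d) / (Real.exp d - Real.exp (-d)) := by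
    rw [rcoth, Real.cosh_eq, Real.sinh_eq]; field_simp; ring
  rw [h6, ← mul_div_assoc, div_eq_div_iff h4 h5, h2]
  linear_combination (-2 * Real.exp (-d)) * h3

lemma rcoth_gt {d : ℝ} (hd : 0 < d) : 1 < rcoth d := by
  have h1 : Real.exp (-2 * d) < 1 := by rw [Real.exp_lt_one_iff]; linarith
  have h2 := rcoth_sub_one hd
  have : 0 < Real.exp (-2 * d) / (1 - Real.exp (-2 * d)) :=
    div_pos (Real.exp_pos _) (by linarith)
  linarith

lemma rcoth_ge {d e : ℝ} (hd : 0 < d) (hde : d ≤ e) :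
    2 * (Real.exp (-2 * e) / (1 - Real.exp (-2 * e))) ≤ rcoth d - 1 := by
  rw [rcoth_sub_one hd]
  have h1 : Real.exp (-2 * d) < 1 := by rw [Real.exp_lt_one_iff]; linarith
  have h2 : Real.exp (-2 * e) ≤ Real.exp (-2 * d) := Real.exp_le_exp.2 (by linarith)
  have := Real.exp_pos (-2 * e)
  have h3 : (0:ℝ) < 1 - Real.exp (-2 * d) := by linarith
  gcongr

/-- scalar primitive -/
noncomputable def prim (c t : ℝ) : ℝ := (1/2) * (Real.log (c + t) - Real.log (c - t))

lemma prim_one {d : ℝ} (hd : 0 < d) : prim (rcoth d) 1 = d := by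
  have h := rcoth_gt hd
  have hs : 0 < Real.sinh d := Real.sinh_pos_iff.2 hd
  have e1 : rcoth d + 1 = Real.exp d / Real.sinh d := by
    rw [rcoth, ← Real.cosh_add_sinh]; field_simp
  have e2 : rcoth d - 1 = Real.exp (-d) / Real.sinh d := by
    rw [rcoth, ← Real.cosh_sub_sinh]; field_simp
  rw [prim, e1, e2, Real.log_div (Real.exp_ne_zero _) hs.ne',
    Real.log_div (Real.exp_ne_zero _) hs.ne', Real.log_exp, Real.log_exp]
  ring

lemma prim_zero (c : ℝ) : prim c 0 = 0 := by simp [prim]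

lemma prim_deriv {c t : ℝ} (hc : 1 < c) (h0 : 0 ≤ t) (h1 : t ≤ 1) :
    HasDerivAt (prim c) (c / (c ^ 2 - t ^ 2)) t := by
  have a1 : c + t ≠ 0 := by linarith
  have a2 : c - t ≠ 0 := by linarith
  have d1 := ((hasDerivAt_id t).const_add c).log a1
  have d2 := ((hasDerivAt_id t).const_sub c).log a2
  have := (d1.sub d2).const_mul (1/2)
  refine this.congr_deriv ?_
  have a3 : c ^ 2 - t ^ 2 ≠ 0 := by
    rw [sq_sub_sq]; exact mul_ne_zero a1 a2
  simp only [id]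
  field_simp
  ring

/-- quadratic form in the symplectic eigenbasis -/
lemma quad_diag {m : ℕ} (c : Fin m → ℝ) (g t : ℝ) (hg : ∀ i, g ≤ c i - 1) (h0 : 0 ≤ t)
    (h1 : t ≤ 1) (w s : Idx m → ℝ) :
    g * (w ⬝ᵥ w + s ⬝ᵥ s) ≤ w ⬝ᵥ pairDiag c *ᵥ w + s ⬝ᵥ pairDiag c *ᵥ s
      - t * (w ⬝ᵥ Omega m *ᵥ s) + t * (s ⬝ᵥ Omega m *ᵥ w) := by
  simp only [dotProduct, Fintype.sum_prod_type, Fin.sum_univ_two, Omega_mulVec, pairDiag,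
    Matrix.mulVec_diagonal, Finset.mul_sum, ← Finset.sum_add_distrib, ← Finset.sum_sub_distrib]
  refine Finset.sum_le_sum fun i _ => ?_
  have hi := hg i
  set w0 := w (i, 0)
  set w1 := w (i, 1)
  set s0 := s (i, 0)
  set s1 := s (i, 1)
  have hnn : 0 ≤ w0 * w0 + w1 * w1 + (s0 * s0 + s1 * s1) :=
    add_nonneg (add_nonneg (mul_self_nonneg _) (mul_self_nonneg _))
      (add_nonneg (mul_self_nonneg _) (mul_self_nonneg _))
  have p1 : 0 ≤ (c i - 1 - g) * (w0 * w0 + w1 * w1 + (s0 * s0 + s1 * s1)) :=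
    mul_nonneg (by linarith) hnn
  have p2 : 0 ≤ (1 - t) * (w0 * w0 + w1 * w1 + (s0 * s0 + s1 * s1)) :=
    mul_nonneg (by linarith) hnn
  have p3 : 0 ≤ t * ((w0 - s1) ^ 2 + (w1 + s0) ^ 2) := by positivity
  nlinarith

section symp
variable {m : ℕ} {S : Matrix (Idx m) (Idx m) ℝ}

lemma symp_right (hS : S * Omega m * Sᵀ = Omega m) : S * (-(Omega m * Sᵀ * Omega m)) = 1 := by
  rw [Matrix.mul_neg, ← Matrix.mul_assoc, ← Matrix.mul_assoc, hS, Omega_mul, neg_neg]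

lemma symp_unit (hS : S * Omega m * Sᵀ = Omega m) : IsUnit S.det :=
  Matrix.isUnit_det_of_right_inverse (symp_right hS)

lemma symp_comm (hS : S * Omega m * Sᵀ = Omega m) : Omega m * (S⁻¹)ᵀ = S * Omega m := by
  have h := symp_unit hS
  have e : Sᵀ * (S⁻¹)ᵀ = 1 := by
    rw [← Matrix.transpose_mul, Matrix.nonsing_inv_mul _ h, Matrix.transpose_one]
  calc Omega m * (S⁻¹)ᵀ = S * Omega m * Sᵀ * (S⁻¹)ᵀ := by rw [hS]
    _ = S * Omega m := by rw [Matrix.mul_assoc, e, Matrix.mul_one]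

/-- `|u|² ≤ ‖S‖² |Sᵀ u|²` -/
lemma symp_bound (hS : S * Omega m * Sᵀ = Omega m) (u : Idx m → ℝ) :
    u ⬝ᵥ u ≤ spNorm S ^ 2 * ((Sᵀ *ᵥ u) ⬝ᵥ (Sᵀ *ᵥ u)) := by
  have e : Omega m *ᵥ u = S *ᵥ (Omega m *ᵥ (Sᵀ *ᵥ u)) := by
    rw [Matrix.mulVec_mulVec, Matrix.mulVec_mulVec, hS]
  rw [← Omega_norm m u, ← Omega_norm m (Sᵀ *ᵥ u), e, ← aux_norm_sq, ← aux_norm_sq, ← mul_pow]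
  exact pow_le_pow_left₀ (norm_nonneg _) (spNorm_mulVec _ _) 2

/-- quadratic form -/
lemma quad_S (hS : S * Omega m * Sᵀ = Omega m) (c : Fin m → ℝ) (g t : ℝ)
    (hg : ∀ i, g ≤ c i - 1) (h0 : 0 ≤ t)
    (h1 : t ≤ 1) (u v : Idx m → ℝ) :
    g * ((Sᵀ *ᵥ u) ⬝ᵥ (Sᵀ *ᵥ u) + (Sᵀ *ᵥ v) ⬝ᵥ (Sᵀ *ᵥ v)) ≤
      u ⬝ᵥ (S * pairDiag c * Sᵀ) *ᵥ u + v ⬝ᵥ (S * pairDiag c * Sᵀ) *ᵥ v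
      - t * (u ⬝ᵥ Omega m *ᵥ v) + t * (v ⬝ᵥ Omega m *ᵥ u) := by
  have key : ∀ (B : Matrix (Idx m) (Idx m) ℝ) (x y : Idx m → ℝ),
      x ⬝ᵥ (S * B * Sᵀ) *ᵥ y = (Sᵀ *ᵥ x) ⬝ᵥ B *ᵥ (Sᵀ *ᵥ y) := by
    intro B x y
    rw [← Matrix.mulVec_mulVec, ← Matrix.mulVec_mulVec, Matrix.dotProduct_mulVec,
      Matrix.mulVec_transpose S x]
  have h := quad_diag c g t hg h0 h1 (Sᵀ *ᵥ u) (Sᵀ *ᵥ v)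
  rw [← key, ← key, ← key, ← key, hS] at h
  exact h

/-- The real part of the resolvent -/
noncomputable def Mt (S : Matrix (Idx m) (Idx m) ℝ) (c : Fin m → ℝ) (t : ℝ) :
    Matrix (Idx m) (Idx m) ℝ :=
  (S⁻¹)ᵀ * pairDiag (fun i => c i / (c i ^ 2 - t ^ 2)) * S⁻¹

/-- The imaginary part of the resolvent -/
noncomputable def Lt (S : Matrix (Idx m) (Idx m) ℝ) (c : Fin m → ℝ) (t : ℝ) :
    Matrix (Idx m) (Idx m) ℝ :=
  (S⁻¹)ᵀ * (Omega m * pairDiag (fun i => - t / (c i ^ 2 - t ^ 2))) * S⁻¹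

lemma pairDiag_mul (c e : Fin m → ℝ) : pairDiag c * pairDiag e = pairDiag (fun i => c i * e i) := by
  simp [pairDiag]

lemma resolvent_one (hS : S * Omega m * Sᵀ = Omega m) (c : Fin m → ℝ) (t : ℝ)
    (hc : ∀ i, 1 < c i) (h0 : 0 ≤ t) (h1 : t ≤ 1) :
    (S * pairDiag c * Sᵀ) * Mt S c t - t • (Omega m * Lt S c t) = 1 := by
  have h := symp_unit hS
  have e : Sᵀ * (S⁻¹)ᵀ = 1 := by
    rw [← Matrix.transpose_mul, Matrix.nonsing_inv_mul _ h, Matrix.transpose_one]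
  have e1 : (S * pairDiag c * Sᵀ) * Mt S c t =
      S * pairDiag (fun i => c i * (c i / (c i ^ 2 - t ^ 2))) * S⁻¹ := by
    rw [Mt, ← pairDiag_mul]
    calc _ = S * pairDiag c * (Sᵀ * (S⁻¹)ᵀ) * pairDiag (fun i => c i / (c i ^ 2 - t ^ 2)) * S⁻¹ := by
          simp only [Matrix.mul_assoc]
      _ = _ := by rw [e]; simp only [Matrix.mul_assoc, Matrix.one_mul]
  have e2 : Omega m * Lt S c t = S * pairDiag (fun i => t / (c i ^ 2 - t ^ 2)) * S⁻¹ := by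
    rw [Lt]
    calc _ = (Omega m * (S⁻¹)ᵀ) * Omega m * pairDiag (fun i => - t / (c i ^ 2 - t ^ 2)) * S⁻¹ := by
          simp only [Matrix.mul_assoc]
      _ = S * (Omega m * Omega m) * pairDiag (fun i => - t / (c i ^ 2 - t ^ 2)) * S⁻¹ := by
          rw [symp_comm hS]; simp only [Matrix.mul_assoc]
      _ = S * (-pairDiag (fun i => - t / (c i ^ 2 - t ^ 2))) * S⁻¹ := by
          rw [Omega_mul]; simp only [Matrix.mul_assoc]; simp
      _ = _ := by
          congr 2
          ext p q
          simp only [pairDiag, Matrix.neg_apply, Matrix.diagonal_apply]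
          split_ifs
          · ring
          · ring
  rw [e1, e2, ← Matrix.smul_mul, ← Matrix.mul_smul, ← Matrix.sub_mul, ← Matrix.mul_sub]
  have e3 : pairDiag (fun i => c i * (c i / (c i ^ 2 - t ^ 2))) -
      t • pairDiag (fun i => t / (c i ^ 2 - t ^ 2)) = (1 : Matrix (Idx m) (Idx m) ℝ) := by
    ext p q
    simp only [pairDiag, Matrix.sub_apply, Matrix.smul_apply, Matrix.diagonal_apply,
      Matrix.one_apply, smul_eq_mul]
    split_ifs
    · have hp := hc p.1
      have : c p.1 ^ 2 - t ^ 2 ≠ 0 := by nlinarith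
      field_simp
    · ring
  rw [e3, Matrix.mul_one, Matrix.mul_nonsing_inv _ h]

lemma resolvent_two (hS : S * Omega m * Sᵀ = Omega m) (c : Fin m → ℝ) (t : ℝ) :
    (S * pairDiag c * Sᵀ) * Lt S c t + t • (Omega m * Mt S c t) = 0 := by
  have h := symp_unit hS
  have e : Sᵀ * (S⁻¹)ᵀ = 1 := by
    rw [← Matrix.transpose_mul, Matrix.nonsing_inv_mul _ h, Matrix.transpose_one]
  have e1 : (S * pairDiag c * Sᵀ) * Lt S c t =
      S * Omega m * pairDiag (fun i => c i * (- t / (c i ^ 2 - t ^ 2))) * S⁻¹ := by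
    rw [Lt, ← pairDiag_mul]
    calc _ = S * pairDiag c * (Sᵀ * (S⁻¹)ᵀ) *
            (Omega m * pairDiag (fun i => - t / (c i ^ 2 - t ^ 2))) * S⁻¹ := by
          simp only [Matrix.mul_assoc]
      _ = S * (pairDiag c * Omega m) * pairDiag (fun i => - t / (c i ^ 2 - t ^ 2)) * S⁻¹ := by
          rw [e]; simp only [Matrix.mul_assoc, Matrix.one_mul]
      _ = _ := by rw [← Omega_comm]; simp only [Matrix.mul_assoc]
  have e2 : Omega m * Mt S c t =
      S * Omega m * pairDiag (fun i => c i / (c i ^ 2 - t ^ 2)) * S⁻¹ := by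
    rw [Mt, ← symp_comm hS]; simp only [Matrix.mul_assoc]
  rw [e1, e2, ← Matrix.smul_mul, ← Matrix.mul_smul, ← Matrix.add_mul, ← Matrix.mul_add]
  have e3 : pairDiag (fun i => c i * (- t / (c i ^ 2 - t ^ 2))) +
      t • pairDiag (fun i => c i / (c i ^ 2 - t ^ 2)) = (0 : Matrix (Idx m) (Idx m) ℝ) := by
    ext p q
    simp only [pairDiag, Matrix.add_apply, Matrix.smul_apply, Matrix.diagonal_apply,
      Matrix.zero_apply, smul_eq_mul]
    split_ifs
    · ring
    · ring
  rw [e3]; simp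

end symp

lemma Omega_skew {m : ℕ} (x y : Idx m → ℝ) :
    x ⬝ᵥ Omega m *ᵥ y = - ((Omega m *ᵥ x) ⬝ᵥ y) := by
  simp only [dotProduct, Fintype.sum_prod_type, Fin.sum_univ_two, Omega_mulVec,
    ← Finset.sum_neg_distrib]
  refine Finset.sum_congr rfl fun i _ => ?_
  ring

lemma symm_dot {ι : Type*} [Fintype ι] (A : Matrix ι ι ℝ) (hA : Aᵀ = A) (x y : ι → ℝ) :
    x ⬝ᵥ A *ᵥ y = (A *ᵥ x) ⬝ᵥ y := by
  rw [Matrix.dotProduct_mulVec, ← Matrix.mulVec_transpose, hA]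

/-- a priori bound for the solution of the resolvent equation -/
lemma sol_bound {b P u x : ℝ} (hb : 0 < b) (hP : 0 ≤ P) (hu : u ≤ P) (hx : 0 ≤ x)
    (h : b * P ^ 2 ≤ u * x) : P ≤ b⁻¹ * x := by
  rcases hP.eq_or_lt with h0 | h0
  · rw [← h0]; positivity
  · have : b * P ≤ x := by
      refine le_of_mul_le_mul_right ?_ h0
      nlinarith
    rw [inv_mul_eq_div, le_div_iff₀ hb]; linarith

lemma scal {a b U₁ V₁ U₂ V₂ X Y : ℝ} (ha : 0 < a) (hb : 0 < b) (pU₁ : 0 ≤ U₁) (pV₁ : 0 ≤ V₁)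
    (pU₂ : 0 ≤ U₂) (pV₂ : 0 ≤ V₂) (pX : 0 ≤ X) (pY : 0 ≤ Y)
    (h1 : a * (U₁ ^ 2 + V₁ ^ 2) ≤ U₁ * X) (h2 : b * (U₂ ^ 2 + V₂ ^ 2) ≤ U₂ * Y) :
    U₁ * U₂ + V₁ * V₂ ≤ (a⁻¹ * X) * (b⁻¹ * Y) := by
  have s1 : Real.sqrt (U₁ ^ 2 + V₁ ^ 2) ≤ a⁻¹ * X := by
    refine sol_bound (u := U₁) ha (Real.sqrt_nonneg _) (Real.le_sqrt_of_sq_le (by linarith [sq_nonneg V₁, sq_nonneg V₂])) pX ?_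
    rw [Real.sq_sqrt (by positivity)]
    assumption
  have s2 : Real.sqrt (U₂ ^ 2 + V₂ ^ 2) ≤ b⁻¹ * Y := by
    refine sol_bound (u := U₂) hb (Real.sqrt_nonneg _) (Real.le_sqrt_of_sq_le (by linarith [sq_nonneg V₁, sq_nonneg V₂])) pY ?_
    rw [Real.sq_sqrt (by positivity)]
    assumption
  have s3 : U₁ * U₂ + V₁ * V₂ ≤ Real.sqrt (U₁ ^ 2 + V₁ ^ 2) * Real.sqrt (U₂ ^ 2 + V₂ ^ 2) := by
    rw [← Real.sqrt_mul (by positivity)]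
    apply Real.le_sqrt_of_sq_le
    nlinarith [sq_nonneg (U₁ * V₂ - U₂ * V₁)]
  exact s3.trans (mul_le_mul s1 s2 (Real.sqrt_nonneg _) (by positivity))

/-- the resolvent difference estimate -/
lemma core {m : ℕ} (A₁ A₂ M₁ M₂ L₁ L₂ : Matrix (Idx m) (Idx m) ℝ) (t a b δ : ℝ)
    (ha : 0 < a) (hb : 0 < b) (hδ : 0 ≤ δ)
    (hA₁ : A₁ᵀ = A₁) (hM₁ : M₁ᵀ = M₁)
    (r1 : A₁ * M₁ - t • (Omega m * L₁) = 1) (r1' : A₁ * L₁ + t • (Omega m * M₁) = 0)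
    (r2 : A₂ * M₂ - t • (Omega m * L₂) = 1) (r2' : A₂ * L₂ + t • (Omega m * M₂) = 0)
    (q1 : ∀ u v : Idx m → ℝ, a * (u ⬝ᵥ u + v ⬝ᵥ v) ≤ u ⬝ᵥ A₁ *ᵥ u + v ⬝ᵥ A₁ *ᵥ v
      - t * (u ⬝ᵥ Omega m *ᵥ v) + t * (v ⬝ᵥ Omega m *ᵥ u))
    (q2 : ∀ u v : Idx m → ℝ, b * (u ⬝ᵥ u + v ⬝ᵥ v) ≤ u ⬝ᵥ A₂ *ᵥ u + v ⬝ᵥ A₂ *ᵥ v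
      - t * (u ⬝ᵥ Omega m *ᵥ v) + t * (v ⬝ᵥ Omega m *ᵥ u))
    (hD : spNorm (A₁ - A₂) ≤ δ) (x y : Idx m → ℝ) :
    |x ⬝ᵥ (M₁ - M₂) *ᵥ y| ≤ (a⁻¹ * b⁻¹ * δ) *
      (‖(WithLp.toLp 2 x : EuclideanSpace ℝ (Idx m))‖ *
      ‖(WithLp.toLp 2 y : EuclideanSpace ℝ (Idx m))‖) := by
  have E : ∀ (A M L : Matrix (Idx m) (Idx m) ℝ), A * M - t • (Omega m * L) = 1 →
      ∀ z, A *ᵥ (M *ᵥ z) - t • (Omega m *ᵥ (L *ᵥ z)) = z := by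
    intro A M L h z
    have := congrArg (· *ᵥ z) h
    simpa [Matrix.sub_mulVec, Matrix.smul_mulVec, ← Matrix.mulVec_mulVec] using this
  have E' : ∀ (A M L : Matrix (Idx m) (Idx m) ℝ), A * L + t • (Omega m * M) = 0 →
      ∀ z, A *ᵥ (L *ᵥ z) + t • (Omega m *ᵥ (M *ᵥ z)) = 0 := by
    intro A M L h z
    have := congrArg (· *ᵥ z) h
    simpa [Matrix.add_mulVec, Matrix.smul_mulVec, ← Matrix.mulVec_mulVec] using this
  have f1 := E _ _ _ r1 x
  have f1' := E' _ _ _ r1' x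
  have f2 := E _ _ _ r2 y
  have f2' := E' _ _ _ r2' y
  have hMx : x ⬝ᵥ M₁ *ᵥ y = (M₁ *ᵥ x) ⬝ᵥ y := symm_dot _ hM₁ _ _
  rw [Matrix.sub_mulVec, dotProduct_sub, hMx]
  have g1 := q1 (M₁ *ᵥ x) (L₁ *ᵥ x)
  have g2 := q2 (M₂ *ᵥ y) (L₂ *ᵥ y)
  set u₁ := M₁ *ᵥ x
  set v₁ := L₁ *ᵥ x
  set u₂ := M₂ *ᵥ y
  set v₂ := L₂ *ᵥ y
  have k1 : u₁ ⬝ᵥ A₁ *ᵥ u₁ - t * (u₁ ⬝ᵥ Omega m *ᵥ v₁) = u₁ ⬝ᵥ x := by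
    have := congrArg (u₁ ⬝ᵥ ·) f1
    simpa [dotProduct_sub, dotProduct_smul] using this
  have k1' : v₁ ⬝ᵥ A₁ *ᵥ v₁ + t * (v₁ ⬝ᵥ Omega m *ᵥ u₁) = 0 := by
    have := congrArg (v₁ ⬝ᵥ ·) f1'
    simpa [dotProduct_add, dotProduct_smul] using this
  have k2 : u₂ ⬝ᵥ A₂ *ᵥ u₂ - t * (u₂ ⬝ᵥ Omega m *ᵥ v₂) = u₂ ⬝ᵥ y := by
    have := congrArg (u₂ ⬝ᵥ ·) f2
    simpa [dotProduct_sub, dotProduct_smul] using this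
  have k2' : v₂ ⬝ᵥ A₂ *ᵥ v₂ + t * (v₂ ⬝ᵥ Omega m *ᵥ u₂) = 0 := by
    have := congrArg (v₂ ⬝ᵥ ·) f2'
    simpa [dotProduct_add, dotProduct_smul] using this
  have c2 : u₁ ⬝ᵥ A₂ *ᵥ u₂ - t * (u₁ ⬝ᵥ Omega m *ᵥ v₂) = u₁ ⬝ᵥ y := by
    have := congrArg (u₁ ⬝ᵥ ·) f2
    simpa [dotProduct_sub, dotProduct_smul] using this
  have c2' : v₁ ⬝ᵥ A₂ *ᵥ v₂ + t * (v₁ ⬝ᵥ Omega m *ᵥ u₂) = 0 := by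
    have := congrArg (v₁ ⬝ᵥ ·) f2'
    simpa [dotProduct_add, dotProduct_smul] using this
  have c1 : u₁ ⬝ᵥ A₁ *ᵥ u₂ + t * (v₁ ⬝ᵥ Omega m *ᵥ u₂) = x ⬝ᵥ u₂ := by
    have := congrArg (· ⬝ᵥ u₂) f1
    rw [symm_dot _ hA₁, Omega_skew]
    simp only [sub_dotProduct, smul_dotProduct, smul_eq_mul] at this
    linarith
  have c1' : v₁ ⬝ᵥ A₁ *ᵥ v₂ - t * (u₁ ⬝ᵥ Omega m *ᵥ v₂) = 0 := by
    have := congrArg (· ⬝ᵥ v₂) f1'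
    rw [symm_dot _ hA₁, Omega_skew]
    simp only [add_dotProduct, smul_dotProduct, smul_eq_mul, zero_dotProduct] at this
    linarith
  have main : u₁ ⬝ᵥ y - x ⬝ᵥ u₂ = -(u₁ ⬝ᵥ (A₁ - A₂) *ᵥ u₂) - v₁ ⬝ᵥ (A₁ - A₂) *ᵥ v₂ := by
    simp only [Matrix.sub_mulVec, dotProduct_sub]
    linarith
  rw [main]
  have b1 := spNorm_bilin (A₁ - A₂) u₁ u₂
  have b2 := spNorm_bilin (A₁ - A₂) v₁ v₂
  have n1 := (le_abs_self _).trans (aux_dot_le u₁ x)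
  have n2 := (le_abs_self _).trans (aux_dot_le u₂ y)
  rw [← aux_norm_sq, ← aux_norm_sq] at g1 g2
  set U₁ := ‖(WithLp.toLp 2 u₁ : EuclideanSpace ℝ (Idx m))‖ with hU₁
  set V₁ := ‖(WithLp.toLp 2 v₁ : EuclideanSpace ℝ (Idx m))‖ with hV₁
  set U₂ := ‖(WithLp.toLp 2 u₂ : EuclideanSpace ℝ (Idx m))‖ with hU₂
  set V₂ := ‖(WithLp.toLp 2 v₂ : EuclideanSpace ℝ (Idx m))‖ with hV₂
  set X := ‖(WithLp.toLp 2 x : EuclideanSpace ℝ (Idx m))‖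
  set Y := ‖(WithLp.toLp 2 y : EuclideanSpace ℝ (Idx m))‖
  have pU₁ : 0 ≤ U₁ := norm_nonneg _
  have pV₁ : 0 ≤ V₁ := norm_nonneg _
  have pU₂ : 0 ≤ U₂ := norm_nonneg _
  have pV₂ : 0 ≤ V₂ := norm_nonneg _
  have pX : 0 ≤ X := norm_nonneg _
  have pY : 0 ≤ Y := norm_nonneg _
  have s4 : U₁ * U₂ + V₁ * V₂ ≤ (a⁻¹ * X) * (b⁻¹ * Y) :=
    scal ha hb pU₁ pV₁ pU₂ pV₂ pX pY (by linarith) (by linarith)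
  calc |-(u₁ ⬝ᵥ (A₁ - A₂) *ᵥ u₂) - v₁ ⬝ᵥ (A₁ - A₂) *ᵥ v₂|
      ≤ |u₁ ⬝ᵥ (A₁ - A₂) *ᵥ u₂| + |v₁ ⬝ᵥ (A₁ - A₂) *ᵥ v₂| := by
        rw [← abs_neg (u₁ ⬝ᵥ (A₁ - A₂) *ᵥ u₂)]; exact abs_sub _ _
    _ ≤ spNorm (A₁ - A₂) * (U₁ * U₂ + V₁ * V₂) := by linarith
    _ ≤ δ * ((a⁻¹ * X) * (b⁻¹ * Y)) := mul_le_mul hD s4 (by positivity) hδ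
    _ = _ := by ring

lemma pairDiag_form {m : ℕ} (T : Matrix (Idx m) (Idx m) ℝ) (e : Fin m → ℝ) (x y : Idx m → ℝ) :
    x ⬝ᵥ (Tᵀ * pairDiag e * T) *ᵥ y = ∑ p, (T *ᵥ x) p * (e p.1 * (T *ᵥ y) p) := by
  rw [← Matrix.mulVec_mulVec, ← Matrix.mulVec_mulVec, Matrix.dotProduct_mulVec,
    Matrix.vecMul_transpose]
  simp [dotProduct, pairDiag, Matrix.mulVec_diagonal]

lemma form_deriv {m : ℕ} (S : Matrix (Idx m) (Idx m) ℝ) (c : Fin m → ℝ) (t : ℝ)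
    (hc : ∀ i, 1 < c i) (h0 : 0 ≤ t) (h1 : t ≤ 1) (x y : Idx m → ℝ) :
    HasDerivAt (fun t => x ⬝ᵥ ((S⁻¹)ᵀ * pairDiag (fun i => prim (c i) t) * S⁻¹) *ᵥ y)
      (x ⬝ᵥ Mt S c t *ᵥ y) t := by
  simp only [Mt, pairDiag_form]
  refine HasDerivAt.fun_sum fun p _ => ?_
  exact ((prim_deriv (hc p.1) h0 h1).mul_const _).const_mul _

lemma conj_symm {m : ℕ} (T : Matrix (Idx m) (Idx m) ℝ) (e : Fin m → ℝ) :
    (T * pairDiag e * Tᵀ)ᵀ = T * pairDiag e * Tᵀ := by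
  simp [pairDiag, Matrix.transpose_mul, Matrix.mul_assoc]

lemma spNorm_smul_two {ι : Type*} [Fintype ι] [DecidableEq ι] (A : Matrix ι ι ℝ) :
    spNorm ((2:ℝ) • A) = 2 * spNorm A := by
  simp [spNorm, norm_smul]

/-- Continuity of the Hamiltonian in the covariance matrix:
with `a := e^{-2 d_max}·‖S‖∞⁻²/(1 - e^{-2 d_max})`, if `‖V₁ - V₂‖∞ < a` then
`‖H₁ - H₂‖∞ ≤ 2·(2a)⁻¹·(2a - 2‖V₁ - V₂‖∞)⁻¹·‖V₁ - V₂‖∞`. -/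
theorem statement6 {m : ℕ} (hm : 0 < m)
    (S₁ S₂ : Matrix (Idx m) (Idx m) ℝ)
    (hS₁ : S₁ * Omega m * S₁ᵀ = Omega m) (hS₂ : S₂ * Omega m * S₂ᵀ = Omega m)
    (d₁ d₂ : Fin m → ℝ) (hd₁ : ∀ i, 0 < d₁ i) (hd₂ : ∀ i, 0 < d₂ i)
    (H₁ H₂ : Matrix (Idx m) (Idx m) ℝ)
    (hH₁ : H₁ = (S₁⁻¹)ᵀ * pairDiag d₁ * S₁⁻¹) (hH₂ : H₂ = (S₂⁻¹)ᵀ * pairDiag d₂ * S₂⁻¹)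
    (V₁ V₂ : Matrix (Idx m) (Idx m) ℝ)
    (hV₁ : V₁ = (1/2 : ℝ) • (S₁ * pairDiag (fun i => rcoth (d₁ i)) * S₁ᵀ))
    (hV₂ : V₂ = (1/2 : ℝ) • (S₂ * pairDiag (fun i => rcoth (d₂ i)) * S₂ᵀ))
    (dmax : ℝ) (hdmax_le : ∀ i, d₁ i ≤ dmax) (hdmax_mem : ∃ i, d₁ i = dmax)
    (a : ℝ)
    (ha : a = Real.exp (-2 * dmax) * (spNorm S₁ ^ 2)⁻¹ / (1 - Real.exp (-2 * dmax)))
    (hVV : spNorm (V₁ - V₂) < a) :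
    spNorm (H₁ - H₂) ≤ 2 * (2 * a)⁻¹ * (2 * a - 2 * spNorm (V₁ - V₂))⁻¹ * spNorm (V₁ - V₂) := by
  have hδ : 0 ≤ spNorm (V₁ - V₂) := spNorm_nonneg' _
  have ha0 : 0 < a := lt_of_le_of_lt hδ hVV
  set δ := spNorm (V₁ - V₂) with hδdef
  set c₁ : Fin m → ℝ := fun i => rcoth (d₁ i) with hc₁
  set c₂ : Fin m → ℝ := fun i => rcoth (d₂ i) with hc₂
  have hc₁' : ∀ i, 1 < c₁ i := fun i => rcoth_gt (hd₁ i)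
  have hc₂' : ∀ i, 1 < c₂ i := fun i => rcoth_gt (hd₂ i)
  set A₁ := S₁ * pairDiag c₁ * S₁ᵀ with hA₁
  set A₂ := S₂ * pairDiag c₂ * S₂ᵀ with hA₂
  have hAA : A₁ - A₂ = (2:ℝ) • (V₁ - V₂) := by
    rw [hV₁, hV₂, ← smul_sub, smul_smul]; norm_num
  have hD : spNorm (A₁ - A₂) = 2 * δ := by rw [hAA, spNorm_smul_two]
  set g := 2 * (Real.exp (-2 * dmax) / (1 - Real.exp (-2 * dmax))) with hg
  have hgc : ∀ i, g ≤ c₁ i - 1 := fun i => rcoth_ge (hd₁ i) (hdmax_le i)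
  have hSn : spNorm S₁ ≠ 0 := by
    intro h
    rw [h] at ha
    simp at ha
    exact ha0.ne' ha
  have hag : 2 * a * spNorm S₁ ^ 2 = g := by
    rw [ha, hg]; field_simp
  have q1 : ∀ t : ℝ, 0 ≤ t → t ≤ 1 → ∀ u v : Idx m → ℝ,
      2 * a * (u ⬝ᵥ u + v ⬝ᵥ v) ≤ u ⬝ᵥ A₁ *ᵥ u + v ⬝ᵥ A₁ *ᵥ v
      - t * (u ⬝ᵥ Omega m *ᵥ v) + t * (v ⬝ᵥ Omega m *ᵥ u) := by
    intro t h0 h1 u v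
    refine le_trans ?_ (quad_S hS₁ c₁ g t hgc h0 h1 u v)
    rw [← hag, mul_assoc (2 * a), mul_add (spNorm S₁ ^ 2)]
    exact mul_le_mul_of_nonneg_left (add_le_add (symp_bound hS₁ u) (symp_bound hS₁ v))
      (by positivity)
  have q2 : ∀ t : ℝ, 0 ≤ t → t ≤ 1 → ∀ u v : Idx m → ℝ,
      (2 * a - 2 * δ) * (u ⬝ᵥ u + v ⬝ᵥ v) ≤ u ⬝ᵥ A₂ *ᵥ u + v ⬝ᵥ A₂ *ᵥ v
      - t * (u ⬝ᵥ Omega m *ᵥ v) + t * (v ⬝ᵥ Omega m *ᵥ u) := by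
    intro t h0 h1 u v
    have h := q1 t h0 h1 u v
    have b1 := (le_abs_self _).trans (spNorm_bilin (A₁ - A₂) u u)
    have b2 := (le_abs_self _).trans (spNorm_bilin (A₁ - A₂) v v)
    rw [← sq, aux_norm_sq, hD, Matrix.sub_mulVec, dotProduct_sub] at b1 b2
    linarith
  have hb0 : 0 < 2 * a - 2 * δ := by linarith
  set K := 2 * (2 * a)⁻¹ * (2 * a - 2 * δ)⁻¹ * δ with hK
  have hK0 : 0 ≤ K := by positivity
  refine spNorm_le_of _ _ hK0 fun x y => ?_
  set N := ‖(WithLp.toLp 2 x : EuclideanSpace ℝ (Idx m))‖ *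
      ‖(WithLp.toLp 2 y : EuclideanSpace ℝ (Idx m))‖ with hN
  let F : ℝ → ℝ := fun t =>
    x ⬝ᵥ ((S₁⁻¹)ᵀ * pairDiag (fun i => prim (c₁ i) t) * S₁⁻¹) *ᵥ y -
    x ⬝ᵥ ((S₂⁻¹)ᵀ * pairDiag (fun i => prim (c₂ i) t) * S₂⁻¹) *ᵥ y
  have hF : ∀ t ∈ Set.Icc (0:ℝ) 1, HasDerivWithinAt F
      (x ⬝ᵥ Mt S₁ c₁ t *ᵥ y - x ⬝ᵥ Mt S₂ c₂ t *ᵥ y) (Set.Icc 0 1) t := fun t ht =>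
    ((form_deriv S₁ c₁ t hc₁' ht.1 ht.2 x y).sub
      (form_deriv S₂ c₂ t hc₂' ht.1 ht.2 x y)).hasDerivWithinAt
  have hbound : ∀ t ∈ Set.Ico (0:ℝ) 1,
      ‖x ⬝ᵥ Mt S₁ c₁ t *ᵥ y - x ⬝ᵥ Mt S₂ c₂ t *ᵥ y‖ ≤ K * N := by
    intro t ht
    have hM : (Mt S₁ c₁ t)ᵀ = Mt S₁ c₁ t := by
      have := conj_symm (S₁⁻¹)ᵀ (fun i => c₁ i / (c₁ i ^ 2 - t ^ 2))
      rwa [Matrix.transpose_transpose] at this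
    have h := core A₁ A₂ (Mt S₁ c₁ t) (Mt S₂ c₂ t) (Lt S₁ c₁ t) (Lt S₂ c₂ t) t
      (2 * a) (2 * a - 2 * δ) (2 * δ) (by linarith) hb0 (by linarith)
      (conj_symm _ _) hM
      (resolvent_one hS₁ c₁ t hc₁' ht.1 ht.2.le) (resolvent_two hS₁ c₁ t)
      (resolvent_one hS₂ c₂ t hc₂' ht.1 ht.2.le) (resolvent_two hS₂ c₂ t)
      (q1 t ht.1 ht.2.le) (q2 t ht.1 ht.2.le) hD.le x y
    rw [Matrix.sub_mulVec, dotProduct_sub] at h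
    rw [Real.norm_eq_abs]
    refine h.trans (le_of_eq ?_)
    rw [hK, hN]; ring
  have hmv := norm_image_sub_le_of_norm_deriv_le_segment_01' hF hbound
  have e1 : F 1 = x ⬝ᵥ (H₁ - H₂) *ᵥ y := by
    have p1 : (fun i => prim (c₁ i) 1) = d₁ := funext fun i => prim_one (hd₁ i)
    have p2 : (fun i => prim (c₂ i) 1) = d₂ := funext fun i => prim_one (hd₂ i)
    simp only [F]
    rw [p1, p2, ← hH₁, ← hH₂, Matrix.sub_mulVec, dotProduct_sub]
  have e0 : F 0 = 0 := by
    simp only [F, pairDiag_form, prim_zero]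
    simp
  rw [e1, e0, sub_zero, Real.norm_eq_abs] at hmv
  exact hmv
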